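/- If ω·p_G ≤ 2/3 and additionally |δ₃(u)| ≤ κ₃‖D_V u‖³/6 for all u ∈ U, for some constant κ₃ ≥ 0, then for every measurable g : ℝ^p → ℝ with |g(u)| ≤ 1 for all u, |∫_U e^{F(u)} g(u) du − ∫_U e^{−‖D_G u‖²/2} g(u) du| ≤ (κ₃/(4(1−ω)^{3/2})) · ∫_{ℝ^p} ‖D_V u‖³ e^{−‖D_G u‖²/2} du. -/

import Mathlib

open MeasureTheory Real Matrix

/-- `gaussNorm D u = ‖D u‖`, the Euclidean norm of the matrix `D` applied to `u`. -/
noncomputable def gaussNorm {p : ℕ} (D : Matrix (Fin p) (Fin p) ℝ)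
    (u : EuclideanSpace ℝ (Fin p)) : ℝ :=
  ‖(Matrix.toEuclideanLin D) u‖

lemma gaussNorm_sq {p : ℕ} (D P : Matrix (Fin p) (Fin p) ℝ) (hD : Dᵀ = D) (w : Fin p → ℝ) :
    gaussNorm D (WithLp.toLp 2 (P *ᵥ w)) ^ 2 = w ⬝ᵥ ((Pᵀ * (D * D) * P) *ᵥ w) := by
  unfold gaussNorm
  rw [EuclideanSpace.norm_sq_eq]
  have : ∀ x : Fin p → ℝ, ∑ i, ‖x i‖ ^ 2 = x ⬝ᵥ x := by
    intro x
    simp [dotProduct, sq]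
  rw [this]
  simp only [toLpLin_apply]
  rw [← mulVec_mulVec, ← mulVec_mulVec, ← mulVec_mulVec, dotProduct_mulVec w, vecMul_transpose,
    dotProduct_mulVec (P *ᵥ w), ← mulVec_transpose, hD]

lemma exists_simul_diag {p : ℕ} (DG DV : Matrix (Fin p) (Fin p) ℝ) (hDG : DG.PosDef)
    (hDV : DV.PosDef) (hL : (DG * DG - DV * DV).PosSemidef) :
    ∃ (P : Matrix (Fin p) (Fin p) ℝ) (b : Fin p → ℝ), IsUnit P.det ∧
      Pᵀ * (DG * DG) * P = 1 ∧ Pᵀ * (DV * DV) * P = diagonal b ∧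
      (∀ i, 0 ≤ b i) ∧ (∀ i, b i ≤ 1) ∧ ∑ i, b i = ((DV * DV) * (DG * DG)⁻¹).trace := by
  have hGt : DGᵀ = DG := by simpa using hDG.isHermitian.eq
  have hVt : DVᵀ = DV := by simpa using hDV.isHermitian.eq
  have hdet : IsUnit DG.det := hDG.det_pos.ne'.isUnit
  have hGit : (DG⁻¹)ᵀ = DG⁻¹ := by rw [transpose_nonsing_inv, hGt]
  have hMh : (DG⁻¹ * (DV * DV) * DG⁻¹).IsHermitian := by
    rw [IsHermitian, conjTranspose_eq_transpose_of_trivial]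
    simp only [transpose_mul, hGit, hVt, Matrix.mul_assoc]
  set M := DG⁻¹ * (DV * DV) * DG⁻¹ with hM
  set Q : Matrix (Fin p) (Fin p) ℝ := (hMh.eigenvectorUnitary : Matrix (Fin p) (Fin p) ℝ) with hQ
  have hQ1 : Qᵀ * Q = 1 := by
    have := Unitary.coe_star_mul_self hMh.eigenvectorUnitary
    simpa [star_eq_conjTranspose] using this
  have hspec : M = Q * diagonal hMh.eigenvalues * Qᵀ := by
    have := hMh.spectral_theorem
    rw [Unitary.conjStarAlgAut_apply] at this
    simpa [star_eq_conjTranspose] using this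
  have hPG : (DG⁻¹ * Q)ᵀ * (DG * DG) * (DG⁻¹ * Q) = 1 := by
    rw [transpose_mul, hGit]
    calc Qᵀ * DG⁻¹ * (DG * DG) * (DG⁻¹ * Q) = Qᵀ * (DG⁻¹ * DG) * (DG * DG⁻¹) * Q := by
          simp only [Matrix.mul_assoc]
      _ = 1 := by rw [nonsing_inv_mul _ hdet, mul_nonsing_inv _ hdet]; simpa using hQ1
  have hPV : (DG⁻¹ * Q)ᵀ * (DV * DV) * (DG⁻¹ * Q) = diagonal hMh.eigenvalues := by
    rw [transpose_mul, hGit]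
    calc Qᵀ * DG⁻¹ * (DV * DV) * (DG⁻¹ * Q) = Qᵀ * M * Q := by
          simp only [hM, Matrix.mul_assoc]
      _ = (Qᵀ * Q) * diagonal hMh.eigenvalues * (Qᵀ * Q) := by
          conv_lhs => rw [hspec]
          simp only [Matrix.mul_assoc]
      _ = _ := by rw [hQ1]; simp
  refine ⟨DG⁻¹ * Q, hMh.eigenvalues, ?_, hPG, hPV, ?_, ?_, ?_⟩
  · have := congrArg det hPG
    simp only [det_mul, det_one] at this ⊢
    rw [isUnit_iff_ne_zero]
    intro h
    rw [h] at this
    simp at this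
  · intro i
    have h1 : (DV * DV).PosSemidef := by
      have := posSemidef_conjTranspose_mul_self DV
      simpa [hVt] using this
    have h2 := h1.conjTranspose_mul_mul_same (DG⁻¹ * Q)
    rw [conjTranspose_eq_transpose_of_trivial, hPV] at h2
    simpa using h2.diag_nonneg (i := i)
  · intro i
    have h2 := hL.conjTranspose_mul_mul_same (DG⁻¹ * Q)
    rw [conjTranspose_eq_transpose_of_trivial, Matrix.mul_sub, Matrix.sub_mul, hPV, hPG] at h2
    simpa using h2.diag_nonneg (i := i)
  · have := hMh.trace_eq_sum_eigenvalues
    simp only [RCLike.ofReal_real_eq_id, id] at this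
    rw [← this, hM, trace_mul_comm, Matrix.mul_inv_rev, ← Matrix.mul_assoc, trace_mul_comm]

lemma one_sub_ge_exp {x : ℝ} (h0 : 0 ≤ x) (h1 : x ≤ 1 / 3) :
    exp (-(3 * log (3 / 2) * x)) ≤ 1 - x := by
  have h := convexOn_exp.2 (Set.mem_univ 0) (Set.mem_univ (-log (3 / 2)))
    (show 0 ≤ 1 - 3 * x by linarith) (show 0 ≤ 3 * x by linarith) (by ring)
  simp only [smul_eq_mul, exp_neg, exp_zero, exp_log (show (0 : ℝ) < 3 / 2 by norm_num)] at h
  calc exp (-(3 * log (3 / 2) * x)) = exp ((1 - 3 * x) * 0 + 3 * x * -log (3 / 2)) := by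
        congr 1; ring
    _ ≤ _ := h
    _ = _ := by ring

lemma prod_ge {p : ℕ} (b : Fin p → ℝ) (ω : ℝ) (hω0 : 0 ≤ ω) (hω : ω ≤ 1 / 3)
    (h0 : ∀ i, 0 ≤ b i) (h1 : ∀ i, b i ≤ 1) (hs : ω * ∑ i, b i ≤ 2 / 3) :
    4 / 9 ≤ ∏ i, (1 - ω * b i) := by
  have hlog : 0 < log (3 / 2) := log_pos (by norm_num)
  calc (4 / 9 : ℝ) = exp (-(2 * log (3 / 2))) := by
        rw [exp_neg, two_mul, exp_add, exp_log (by norm_num)]; norm_num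
    _ ≤ exp (∑ i, -(3 * log (3 / 2) * (ω * b i))) := by
        apply exp_le_exp.2
        rw [Finset.sum_neg_distrib, ← Finset.mul_sum, ← Finset.mul_sum]
        nlinarith
    _ = ∏ i, exp (-(3 * log (3 / 2) * (ω * b i))) := exp_sum _ _
    _ ≤ _ := by
        apply Finset.prod_le_prod
        · intros; positivity
        · intro i _
          apply one_sub_ge_exp
          · exact mul_nonneg hω0 (h0 i)
          · nlinarith [h0 i, h1 i]

lemma exists_T {p : ℕ} (DG DV : Matrix (Fin p) (Fin p) ℝ) (hDG : DG.PosDef)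
    (hDV : DV.PosDef) (hL : (DG * DG - DV * DV).PosSemidef) (ω : ℝ) (hω0 : 0 ≤ ω)
    (hω : ω ≤ 1 / 3) (hs : ω * ((DV * DV) * (DG * DG)⁻¹).trace ≤ 2 / 3) :
    ∃ T : EuclideanSpace ℝ (Fin p) →ₗ[ℝ] EuclideanSpace ℝ (Fin p),
      0 < LinearMap.det T ∧ LinearMap.det T ≤ 3 / 2 ∧
      (∀ u, gaussNorm DG (T u) ^ 2 - ω * gaussNorm DV (T u) ^ 2 = gaussNorm DG u ^ 2) ∧
      (∀ u, gaussNorm DV (T u) ^ 2 ≤ gaussNorm DV u ^ 2 / (1 - ω)) := by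
  have hGt : DGᵀ = DG := by simpa using hDG.isHermitian.eq
  have hVt : DVᵀ = DV := by simpa using hDV.isHermitian.eq
  obtain ⟨P, b, hP, hPG, hPV, h0, h1, hsum⟩ := exists_simul_diag DG DV hDG hDV hL
  rw [← hsum] at hs
  have hpos : ∀ i, 1 - ω ≤ 1 - ω * b i := fun i => by nlinarith [h0 i, h1 i]
  have hpos' : ∀ i, 0 < 1 - ω * b i := fun i => by linarith [hpos i]
  let s : Fin p → ℝ := fun i => (√(1 - ω * b i))⁻¹
  have hs2 : ∀ i, s i ^ 2 = (1 - ω * b i)⁻¹ := fun i => by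
    simp only [s, inv_pow]; rw [sq_sqrt (hpos' i).le]
  have hG : ∀ w : Fin p → ℝ, gaussNorm DG (WithLp.toLp 2 (P *ᵥ w)) ^ 2 = ∑ i, w i ^ 2 := by
    intro w
    rw [gaussNorm_sq DG P hGt, hPG]; simp [dotProduct, sq]
  have hV : ∀ w : Fin p → ℝ, gaussNorm DV (WithLp.toLp 2 (P *ᵥ w)) ^ 2 = ∑ i, b i * w i ^ 2 := by
    intro w
    rw [gaussNorm_sq DV P hVt, hPV]
    simp only [dotProduct, mulVec_diagonal]
    exact Finset.sum_congr rfl fun i _ => by ring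
  have key : ∀ u : EuclideanSpace ℝ (Fin p), ∃ w : Fin p → ℝ, u = WithLp.toLp 2 (P *ᵥ w) ∧
      toEuclideanLin (P * diagonal s * P⁻¹) u = WithLp.toLp 2 (P *ᵥ fun i => s i * w i) := by
    intro u
    refine ⟨P⁻¹ *ᵥ u.ofLp, ?_, ?_⟩
    · rw [mulVec_mulVec, mul_nonsing_inv _ hP]; simp
    · rw [toLpLin_apply, ← mulVec_mulVec, ← mulVec_mulVec]
      congr 2
      ext i
      rw [mulVec_diagonal]
  have hdet : LinearMap.det (toEuclideanLin (P * diagonal s * P⁻¹)) = ∏ i, s i := by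
    rw [LinearMap.det_toLpLin, det_mul_right_comm, det_mul, det_mul, det_nonsing_inv,
      Ring.mul_inverse_cancel _ hP, one_mul, det_diagonal]
  have hprod := prod_ge b ω hω0 hω h0 h1 hs
  have hspos : 0 < ∏ i, s i := Finset.prod_pos fun i _ => inv_pos.2 (sqrt_pos.2 (hpos' i))
  refine ⟨toEuclideanLin (P * diagonal s * P⁻¹), ?_, ?_, ?_, ?_⟩
  · rw [hdet]; exact hspos
  · rw [hdet]
    have : (∏ i, s i) ^ 2 ≤ (3 / 2) ^ 2 := by
      rw [← Finset.prod_pow]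
      simp only [hs2]
      rw [Finset.prod_inv_distrib]
      calc _ ≤ (4 / 9 : ℝ)⁻¹ := inv_anti₀ (by norm_num) hprod
        _ = _ := by norm_num
    exact le_of_sq_le_sq this (by norm_num)
  · intro u
    obtain ⟨w, hw, hT⟩ := key u
    rw [hT, hw, hG, hV, hG, Finset.mul_sum, ← Finset.sum_sub_distrib]
    refine Finset.sum_congr rfl fun i _ => ?_
    rw [mul_pow, hs2]
    have := (hpos' i).ne'
    field_simp
  · intro u
    obtain ⟨w, hw, hT⟩ := key u
    rw [hT, hw, hV, hV, Finset.sum_div]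
    refine Finset.sum_le_sum fun i _ => ?_
    rw [mul_pow, hs2, div_eq_mul_inv]
    have : (1 - ω * b i)⁻¹ ≤ (1 - ω)⁻¹ := inv_anti₀ (by linarith) (hpos i)
    have := mul_le_mul_of_nonneg_left this (mul_nonneg (h0 i) (sq_nonneg (w i)))
    linarith

lemma gaussNorm_cont {p : ℕ} (D : Matrix (Fin p) (Fin p) ℝ) : Continuous (gaussNorm D) := by
  unfold gaussNorm
  exact (LinearMap.continuous_of_finiteDimensional _).norm

lemma comp_linear {p : ℕ} (T : EuclideanSpace ℝ (Fin p) →ₗ[ℝ] EuclideanSpace ℝ (Fin p))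
    (hT : LinearMap.det T ≠ 0) (f : EuclideanSpace ℝ (Fin p) → ℝ) :
    (Integrable f → Integrable (fun u => f (T u))) ∧
      ∫ u, f u = |LinearMap.det T| * ∫ u, f (T u) := by
  let e := (LinearEquiv.ofIsUnitDet (f := T) (v := (EuclideanSpace.basisFun (Fin p) ℝ).toBasis)
    (v' := (EuclideanSpace.basisFun (Fin p) ℝ).toBasis)
    (by rw [LinearMap.det_toMatrix]; exact hT.isUnit)).toContinuousLinearEquiv.toHomeomorph
  let em := e.toMeasurableEquiv
  have he : (em : EuclideanSpace ℝ (Fin p) → EuclideanSpace ℝ (Fin p)) = T := rfl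
  have hm := Measure.map_linearMap_addHaar_eq_smul_addHaar
    (volume : Measure (EuclideanSpace ℝ (Fin p))) hT
  rw [← he] at hm
  constructor
  · intro hf
    have h2 : Integrable f (Measure.map em volume) := by
      rw [hm]; exact hf.smul_measure (by simp)
    exact (integrable_map_equiv em f).1 h2
  · have h2 := integral_map_equiv (μ := volume) em f
    rw [hm, integral_smul_measure, ENNReal.toReal_ofReal (abs_nonneg _)] at h2
    rw [he] at h2
    rw [← h2, smul_eq_mul, abs_inv, ← mul_assoc, mul_inv_cancel₀ (abs_ne_zero.2 hT), one_mul]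

lemma gauss_integrable {p : ℕ} (D : Matrix (Fin p) (Fin p) ℝ) (hD : D.PosDef) (c : ℝ)
    (hc : 0 < c) : Integrable (fun u : EuclideanSpace ℝ (Fin p) => exp (-c * gaussNorm D u ^ 2)) := by
  have h := GaussianFourier.integrable_cexp_neg_mul_sq_norm_add (b := (c : ℂ))
    (V := EuclideanSpace ℝ (Fin p)) (by simpa using hc) 0 0
  have h' : Integrable (fun u : EuclideanSpace ℝ (Fin p) => exp (-c * ‖u‖ ^ 2)) := by
    refine h.norm.congr (Filter.Eventually.of_forall fun u => ?_)
    simp only [Complex.norm_exp]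
    congr 1
    have : (-(c : ℂ) * (‖u‖ : ℂ) ^ 2) = ((-c * ‖u‖ ^ 2 : ℝ) : ℂ) := by push_cast; ring
    simp only [zero_mul, add_zero]
    rw [this, Complex.ofReal_re]
  exact (comp_linear (toEuclideanLin D) (by
    rw [LinearMap.det_toLpLin]; exact hD.det_pos.ne') _).1 h'

lemma gauss_le {p : ℕ} (DG DV : Matrix (Fin p) (Fin p) ℝ) (hDG : DG.PosDef)
    (hDV : DV.PosDef) (hL : (DG * DG - DV * DV).PosSemidef) (u : EuclideanSpace ℝ (Fin p)) :
    gaussNorm DV u ^ 2 ≤ gaussNorm DG u ^ 2 := by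
  have hGt : DGᵀ = DG := by simpa using hDG.isHermitian.eq
  have hVt : DVᵀ = DV := by simpa using hDV.isHermitian.eq
  have h1 := gaussNorm_sq DG 1 hGt u.ofLp
  have h2 := gaussNorm_sq DV 1 hVt u.ofLp
  have h3 := hL.dotProduct_mulVec_nonneg u.ofLp
  simp only [one_mulVec, transpose_one, Matrix.one_mul, Matrix.mul_one] at h1 h2
  rw [sub_mulVec, dotProduct_sub] at h3
  simp only [star_trivial] at h3
  rw [h1, h2]
  linarith

lemma cube_le (x : ℝ) : x ^ 3 ≤ 73 * exp (x ^ 2 / 6) := by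
  have h := quadratic_le_exp_of_nonneg (x := x ^ 2 / 6) (by positivity)
  nlinarith [sq_nonneg (x ^ 2 - x), sq_nonneg (x - 1), sq_nonneg x, sq_nonneg (x^2)]

lemma cube_integrable {p : ℕ} (DG DV : Matrix (Fin p) (Fin p) ℝ) (hDG : DG.PosDef)
    (hDV : DV.PosDef) (hL : (DG * DG - DV * DV).PosSemidef) (ω : ℝ) (hω0 : 0 ≤ ω)
    (hω : ω ≤ 1 / 3) :
    Integrable (fun u => gaussNorm DV u ^ 3 *
      exp (-(gaussNorm DG u) ^ 2 / 2 + ω * gaussNorm DV u ^ 2 / 2)) := by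
  refine ((gauss_integrable DG hDG (1 / 6) (by norm_num)).const_mul 73).mono' ?_ ?_
  · have h1 := gaussNorm_cont DG
    have h2 := gaussNorm_cont DV
    exact Continuous.aestronglyMeasurable (by fun_prop)
  · refine Filter.Eventually.of_forall fun u => ?_
    have hn : 0 ≤ gaussNorm DV u := norm_nonneg _
    have hle := gauss_le DG DV hDG hDV hL u
    rw [norm_of_nonneg (by positivity)]
    calc _ ≤ 73 * exp (gaussNorm DV u ^ 2 / 6) *
          exp (-(gaussNorm DG u) ^ 2 / 2 + ω * gaussNorm DV u ^ 2 / 2) := by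
          gcongr; exact cube_le _
      _ = 73 * exp (gaussNorm DV u ^ 2 / 6 +
          (-(gaussNorm DG u) ^ 2 / 2 + ω * gaussNorm DV u ^ 2 / 2)) := by
          rw [exp_add (gaussNorm DV u ^ 2 / 6)]; ring
      _ ≤ _ := by
          gcongr
          nlinarith [sq_nonneg (gaussNorm DV u)]

lemma exp_sub_one_le (d : ℝ) : |exp d - 1| ≤ |d| * exp |d| := by
  rcases le_total 0 d with h | h
  · rw [abs_of_nonneg h, abs_of_nonneg (by linarith [add_one_le_exp d])]
    have := add_one_le_exp (-d)
    have h2 : exp (-d) * exp d = 1 := by rw [← exp_add]; simp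
    nlinarith [exp_pos d]
  · rw [abs_of_nonpos h, abs_of_nonpos (by linarith [exp_le_one_iff.2 h])]
    have := add_one_le_exp d
    have h2 : 1 ≤ exp (-d) := one_le_exp (by linarith)
    nlinarith

theorem stmt_8 (p : ℕ)
    (DG DV : Matrix (Fin p) (Fin p) ℝ) (hDG : DG.PosDef) (hDV : DV.PosDef)
    (hLoewner : (DG * DG - DV * DV).PosSemidef)
    (pG Z : ℝ) (hpG : pG = ((DV * DV) * (DG * DG)⁻¹).trace)
    (hZ : Z = ∫ u : EuclideanSpace ℝ (Fin p), exp (-(gaussNorm DG u) ^ 2 / 2))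
    (F : EuclideanSpace ℝ (Fin p) → ℝ) (hFmeas : Measurable F)
    (U : Set (EuclideanSpace ℝ (Fin p))) (hU : MeasurableSet U)
    (ω : ℝ) (hω0 : 0 ≤ ω) (hω : ω ≤ 1 / 3)
    (hδ3 : ∀ u ∈ U, |F u + (gaussNorm DG u) ^ 2 / 2| ≤ ω * (gaussNorm DV u) ^ 2 / 2)
    (hωpG : ω * pG ≤ 2 / 3)
    (κ₃ : ℝ) (hκ₃ : 0 ≤ κ₃)
    (hδ3cube : ∀ u ∈ U, |F u + (gaussNorm DG u) ^ 2 / 2| ≤ κ₃ * (gaussNorm DV u) ^ 3 / 6)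
    (g : EuclideanSpace ℝ (Fin p) → ℝ) (hgmeas : Measurable g) (hg : ∀ u, |g u| ≤ 1) :
    |(∫ u in U, exp (F u) * g u) -
        ∫ u in U, exp (-(gaussNorm DG u) ^ 2 / 2) * g u| ≤
      κ₃ / (4 * (1 - ω) ^ ((3 : ℝ) / 2)) *
        ∫ u : EuclideanSpace ℝ (Fin p),
          (gaussNorm DV u) ^ 3 * exp (-(gaussNorm DG u) ^ 2 / 2) := by
  have hcG := gaussNorm_cont DG
  have hcV := gaussNorm_cont DV
  have hnV : ∀ u, 0 ≤ gaussNorm DV u := fun u => norm_nonneg _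
  set B : EuclideanSpace ℝ (Fin p) → ℝ := fun u => gaussNorm DV u ^ 3 *
      exp (-(gaussNorm DG u) ^ 2 / 2 + ω * gaussNorm DV u ^ 2 / 2) with hB
  have hBint : Integrable B := cube_integrable DG DV hDG hDV hLoewner ω hω0 hω
  have hB0 : ∀ u, 0 ≤ B u := fun u => mul_nonneg (pow_nonneg (hnV u) 3) (exp_pos _).le
  have hI0 : Integrable (fun u => gaussNorm DV u ^ 3 * exp (-(gaussNorm DG u) ^ 2 / 2)) := by
    have := cube_integrable DG DV hDG hDV hLoewner 0 le_rfl (by norm_num)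
    simpa using this
  -- pointwise bound
  have hpt : ∀ u ∈ U, ‖exp (F u) * g u - exp (-(gaussNorm DG u) ^ 2 / 2) * g u‖ ≤
      κ₃ / 6 * B u := by
    intro u hu
    set d := F u + (gaussNorm DG u) ^ 2 / 2 with hd
    have hF : exp (F u) = exp (-(gaussNorm DG u) ^ 2 / 2) * exp d := by
      rw [← exp_add]; congr 1; rw [hd]; ring
    have h1 := exp_sub_one_le d
    have h2 : |d| * exp |d| ≤ κ₃ * gaussNorm DV u ^ 3 / 6 * exp (ω * gaussNorm DV u ^ 2 / 2) := by
      have := pow_nonneg (hnV u) 3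
      exact mul_le_mul (hδ3cube u hu) (exp_le_exp.2 (hδ3 u hu)) (exp_pos _).le (by positivity)
    rw [hF, ← sub_mul, norm_mul, Real.norm_eq_abs, Real.norm_eq_abs]
    calc _ ≤ |exp (-(gaussNorm DG u) ^ 2 / 2) * exp d - exp (-(gaussNorm DG u) ^ 2 / 2)| * 1 := by
          gcongr; exact hg u
      _ = exp (-(gaussNorm DG u) ^ 2 / 2) * |exp d - 1| := by
          rw [mul_one, ← mul_sub_one, abs_mul, abs_of_pos (exp_pos _)]
      _ ≤ exp (-(gaussNorm DG u) ^ 2 / 2) *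
          (κ₃ * gaussNorm DV u ^ 3 / 6 * exp (ω * gaussNorm DV u ^ 2 / 2)) := by
          gcongr; exact h1.trans h2
      _ = _ := by simp only [hB, exp_add]; ring
  have hae : ∀ᵐ u ∂(volume.restrict U),
      ‖exp (F u) * g u - exp (-(gaussNorm DG u) ^ 2 / 2) * g u‖ ≤ κ₃ / 6 * B u :=
    (ae_restrict_iff' hU).2 (Filter.Eventually.of_forall hpt)
  have hmG : Measurable (fun u => exp (-(gaussNorm DG u) ^ 2 / 2) * g u) := by
    have := hcG.measurable
    fun_prop
  have hmF : Measurable (fun u => exp (F u) * g u) := by fun_prop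
  have hiG : Integrable (fun u => exp (-(gaussNorm DG u) ^ 2 / 2) * g u) := by
    refine (gauss_integrable DG hDG (1 / 2) (by norm_num)).mono' hmG.aestronglyMeasurable ?_
    refine Filter.Eventually.of_forall fun u => ?_
    rw [norm_mul, Real.norm_eq_abs, Real.norm_eq_abs, abs_of_pos (exp_pos _)]
    calc _ ≤ exp (-(gaussNorm DG u) ^ 2 / 2) * 1 := by gcongr; exact hg u
      _ = _ := by rw [mul_one]; congr 1; ring
  have hiD : Integrable (fun u => exp (F u) * g u - exp (-(gaussNorm DG u) ^ 2 / 2) * g u)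
      (volume.restrict U) :=
    (hBint.restrict.const_mul (κ₃ / 6)).mono' (hmF.sub hmG).aestronglyMeasurable hae
  have hiF : Integrable (fun u => exp (F u) * g u) (volume.restrict U) := by
    have := hiD.add hiG.restrict
    refine this.congr (Filter.Eventually.of_forall fun u => ?_)
    simp
  rw [← integral_sub hiF hiG.restrict]
  have step1 : |∫ u in U, (exp (F u) * g u - exp (-(gaussNorm DG u) ^ 2 / 2) * g u)| ≤
      κ₃ / 6 * ∫ u, B u := by
    rw [← Real.norm_eq_abs, ← integral_const_mul]
    refine (norm_integral_le_of_norm_le (hBint.restrict.const_mul (κ₃ / 6)) hae).trans ?_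
    exact setIntegral_le_integral (hBint.const_mul _)
      (Filter.Eventually.of_forall fun u => mul_nonneg (by positivity) (hB0 u))
  have step2 : ∫ u, B u ≤ 3 / 2 * (((1 - ω) ^ ((3 : ℝ) / 2))⁻¹ *
      ∫ u, gaussNorm DV u ^ 3 * exp (-(gaussNorm DG u) ^ 2 / 2)) := by
    obtain ⟨T, hT0, hT1, hTG, hTV⟩ :=
      exists_T DG DV hDG hDV hLoewner ω hω0 hω (by rw [← hpG]; exact hωpG)
    obtain ⟨hc1, hc2⟩ := comp_linear T hT0.ne' B
    rw [hc2, abs_of_pos hT0]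
    have hle : ∫ u, B (T u) ≤ ((1 - ω) ^ ((3 : ℝ) / 2))⁻¹ *
        ∫ u, gaussNorm DV u ^ 3 * exp (-(gaussNorm DG u) ^ 2 / 2) := by
      rw [← integral_const_mul]
      refine integral_mono (hc1 hBint) (hI0.const_mul _) fun u => ?_
      have e1 : B (T u) = gaussNorm DV (T u) ^ 3 * exp (-(gaussNorm DG u) ^ 2 / 2) := by
        simp only [hB]
        congr 2
        linarith [hTG u]
      have h1ω : 0 < 1 - ω := by linarith
      have cube : ∀ x : ℝ, 0 ≤ x → x ^ 3 = (x ^ 2) ^ ((3 : ℝ) / 2) := by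
        intro x hx
        rw [← rpow_natCast x 2, ← rpow_mul hx, ← rpow_natCast]
        norm_num
      have e2 : gaussNorm DV (T u) ^ 3 ≤ ((1 - ω) ^ ((3 : ℝ) / 2))⁻¹ * gaussNorm DV u ^ 3 := by
        rw [cube _ (hnV _), cube _ (hnV u), mul_comm, ← div_eq_mul_inv,
          ← div_rpow (sq_nonneg _) h1ω.le]
        exact rpow_le_rpow (sq_nonneg _) (hTV u) (by norm_num)
      simp only [e1]
      rw [← mul_assoc]
      gcongr
    have h0 : 0 ≤ ∫ u, B (T u) := integral_nonneg fun u => hB0 _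
    exact mul_le_mul hT1 hle h0 (by norm_num)
  calc _ ≤ κ₃ / 6 * ∫ u, B u := step1
    _ ≤ κ₃ / 6 * _ := mul_le_mul_of_nonneg_left step2 (by positivity)
    _ = _ := by
      rw [div_mul_eq_div_div, div_eq_mul_inv _ ((1 - ω) ^ ((3 : ℝ) / 2))]; ring
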